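/- Corollary 1 (weak model selection). Under the hypotheses of Theorem 2 (clipped GLM setup, λ_n satisfying Assumption L₀, IC(Model) and IC(Joint) assumptions, n large enough that b_n log d_n < n), if the hyperparameter a_n additionally satisfies a_n ≥ 1 + 2 b_n E₁ with E₁ := 8(1 + 49 M(A,X)²/(8 φ_{B_n}(A,X)²)), then sup_{β* ∈ B_n} E[ Π_n( supp(β) ⊋ S* | Y^{(n)} ) ] → 0 as n → ∞; that is, the posterior probability of models that are strict supersets of the true model S* vanishes uniformly over β* ∈ B_n. -/

import Mathlib

open MeasureTheory Real Filter

noncomputable section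

/-- Density of a one-parameter canonical exponential family member with
canonical parameter `θ`, base function `h`, sufficient statistic `T` and
log-partition function `A`. -/
def expFamDensity (h T A : ℝ → ℝ) (θ : ℝ) (y : ℝ) : ℝ :=
  h y * Real.exp (θ * T y - A θ)

/-- The exponential family member as a measure on `ℝ`. -/
def expFamMeasure (μ : Measure ℝ) (h T A : ℝ → ℝ) (θ : ℝ) : Measure ℝ :=
  μ.withDensity fun y => ENNReal.ofReal (expFamDensity h T A θ y)

/-- Joint distribution of `n` independent observations with parameters `θ i`. -/
def dataMeasure (μ : Measure ℝ) (h T A : ℝ → ℝ) (n : ℕ) (θ : Fin n → ℝ) :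
    Measure (Fin n → ℝ) :=
  Measure.pi fun i => expFamMeasure μ h T A (θ i)

/-- The ℓ₁ norm on `ℝ^m`. -/
def l1 {m : ℕ} (v : Fin m → ℝ) : ℝ := ∑ j, |v j|

/-- The support (set of nonzero coordinates) of a vector. -/
def suppSet {m : ℕ} (v : Fin m → ℝ) : Finset (Fin m) :=
  Finset.univ.filter fun j => v j ≠ 0

/-- `restr S v` agrees with `v` on `S` and is zero off `S`. -/
def restr {m : ℕ} (S : Finset (Fin m)) (v : Fin m → ℝ) : Fin m → ℝ :=
  fun j => if j ∈ S then v j else 0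

/-- The Laplace distribution with rate `lam` as a measure on `ℝ`. -/
def laplaceMeasure (lam : ℝ) : Measure ℝ :=
  volume.withDensity fun x => ENNReal.ofReal (lam / 2 * Real.exp (-(lam * |x|)))

/-- Given a model `S`, independent Laplace coordinates on `S` and point
masses at zero off `S`. -/
def modelMeasure (dn : ℕ) (lam : ℝ) (S : Finset (Fin dn)) : Measure (Fin dn → ℝ) :=
  Measure.pi fun j => if j ∈ S then laplaceMeasure lam else Measure.dirac 0

/-- The spike-and-Laplace complexity prior `Π_n` on `ℝ^{d_n}` with
hyperparameters `lam = λ_n`, `a = a_n` and normalizer `C = C_n`. -/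
def priorMeasure (dn : ℕ) (lam a C : ℝ) : Measure (Fin dn → ℝ) :=
  ∑ S : Finset (Fin dn),
    ENNReal.ofReal (C * ((dn.choose S.card : ℝ))⁻¹ * ((dn : ℝ) ^ (-a)) ^ S.card) •
      modelMeasure dn lam S

/-- `η_i = η(x_iᵀ β)`. -/
def etaVec (ηf : ℝ → ℝ) {n dn : ℕ} (X : Matrix (Fin n) (Fin dn) ℝ) (β : Fin dn → ℝ)
    (i : Fin n) : ℝ :=
  ηf (∑ j, X i j * β j)

/-- The Kullback--Leibler divergence `D_n(θ* ‖ θ)`, expressed as the Bregman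
divergence of the log-partition function. -/
def klDiv (A : ℝ → ℝ) {n : ℕ} (θstar θ : Fin n → ℝ) : ℝ :=
  ∑ i, (A (θ i) - A (θstar i) - (θ i - θstar i) * deriv A (θstar i))

/-- The centered stochastic term `Z_n(θ, θ*)`; `ET i` is the mean of `T(y_i)`. -/
def centeredZ (T : ℝ → ℝ) {n : ℕ} (ET θstar θ : Fin n → ℝ) (y : Fin n → ℝ) : ℝ :=
  ∑ i, (T (y i) - ET i) * (θ i - θstar i)

/-- The log-likelihood ratio `L_n(η, η*) = Z_n(η, η*) - D_n(η* ‖ η)`. -/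
def logLR (μ : Measure ℝ) (h T A ηf : ℝ → ℝ) {n dn : ℕ} (X : Matrix (Fin n) (Fin dn) ℝ)
    (βstar β : Fin dn → ℝ) (y : Fin n → ℝ) : ℝ :=
  centeredZ T (fun i => ∫ z, T z ∂(expFamMeasure μ h T A (etaVec ηf X βstar i)))
      (etaVec ηf X βstar) (etaVec ηf X β) y
    - klDiv A (etaVec ηf X βstar) (etaVec ηf X β)

/-- The marginal likelihood `∫ exp(L_n(η,η*)) dΠ_n(β)`. -/
def marginalLik (μ : Measure ℝ) (h T A ηf : ℝ → ℝ) {n : ℕ} (dn : ℕ)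
    (X : Matrix (Fin n) (Fin dn) ℝ) (βstar : Fin dn → ℝ) (lam a C : ℝ)
    (y : Fin n → ℝ) : ℝ :=
  ∫ β, Real.exp (logLR μ h T A ηf X βstar β y) ∂(priorMeasure dn lam a C)

/-- The posterior probability of a set `B` given data `y`. -/
def posterior (μ : Measure ℝ) (h T A ηf : ℝ → ℝ) {n : ℕ} (dn : ℕ)
    (X : Matrix (Fin n) (Fin dn) ℝ) (βstar : Fin dn → ℝ) (lam a C : ℝ)
    (B : Set (Fin dn → ℝ)) (y : Fin n → ℝ) : ℝ :=
  (∫ β in B, Real.exp (logLR μ h T A ηf X βstar β y) ∂(priorMeasure dn lam a C)) /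
    marginalLik μ h T A ηf dn X βstar lam a C y

/-- `‖X‖_{(∞,∞)} = max_{i,j} |X_{ij}|`. -/
def Xnorm {n dn : ℕ} (X : Matrix (Fin n) (Fin dn) ℝ) : ℝ := ⨆ i, ⨆ j, |X i j|

/-- `M(A, X) = ‖X‖_{(∞,∞)} · M₁(A)` with `M₁(A) = (1 ⊓ M₀(A)⁻¹)⁻¹`. -/
def Mconst (M0 : ℝ) {n dn : ℕ} (X : Matrix (Fin n) (Fin dn) ℝ) : ℝ :=
  Xnorm X * (min 1 M0⁻¹)⁻¹

/-- `B_n = B_{1,n} ∩ B_{2,n}`: vectors whose support has positive compatibility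
constant and whose sparsity is positive and at most `b_n`. -/
def Bset (d : ℕ → ℕ) (b : ℕ → ℝ) (φ1 : ∀ n : ℕ, Finset (Fin (d n)) → ℝ) (n : ℕ) :
    Set (Fin (d n) → ℝ) :=
  {β | 0 < φ1 n (suppSet β) ∧ 0 < (suppSet β).card ∧ ((suppSet β).card : ℝ) ≤ b n}

/-- `φ_{B_n}(A, X) = inf {φ₁(A, X, S*) : β* ∈ B_n}`. -/
def phiBn (d : ℕ → ℕ) (b : ℕ → ℝ) (φ1 : ∀ n : ℕ, Finset (Fin (d n)) → ℝ) (n : ℕ) : ℝ :=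
  sInf ((fun βs => φ1 n (suppSet βs)) '' (Bset d b φ1 n))

section ExponentialFamily

/-- A continuous injective function into a convex set of reals takes values in its interior. -/
lemma mem_interior_of_continuous_injective {f : ℝ → ℝ} {s : Set ℝ} (hs : Convex ℝ s)
    (hf : Continuous f) (hinj : Function.Injective f) (hmem : ∀ t, f t ∈ s) (t : ℝ) :
    f t ∈ interior s := by
  have key : ∀ u v : ℝ, f u < f t → f t < f v → f t ∈ interior s := fun u v hu hv =>
    mem_interior.2 ⟨Set.Ioo (f u) (f v),
      Set.Ioo_subset_Icc_self.trans (hs.ordConnected.out (hmem u) (hmem v)), isOpen_Ioo, hu, hv⟩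
  rcases hf.strictMono_of_inj hinj with hm | hm
  · exact key (t - 1) (t + 1) (hm (by linarith)) (hm (by linarith))
  · exact key (t + 1) (t - 1) (hm (by linarith)) (hm (by linarith))

/-- A function with second derivative bounded by `K` on an interval has Bregman divergence at most
`K (y - x) ^ 2`. -/
lemma bregman_le {A : ℝ → ℝ} {J : Set ℝ} (hJ : Convex ℝ J) {K : ℝ}
    (hd : ∀ x ∈ J, DifferentiableAt ℝ A x) (hdd : ∀ x ∈ J, DifferentiableAt ℝ (deriv A) x)
    (hK : ∀ x ∈ J, |deriv (deriv A) x| ≤ K) {x y : ℝ} (hx : x ∈ J) (hy : y ∈ J) :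
    A y - A x - (y - x) * deriv A x ≤ K * (y - x) ^ 2 := by
  have hK0 : 0 ≤ K := (abs_nonneg _).trans (hK x hx)
  have hlip : ∀ z ∈ J, |deriv A z - deriv A x| ≤ K * |z - x| := fun z hz => by
    simpa [Real.norm_eq_abs] using hJ.norm_image_sub_le_of_norm_deriv_le (f := deriv A)
      (fun w hw => hdd w hw) (fun w hw => hK w hw) hx hz
  have hseg : Set.uIcc x y ⊆ J := hJ.ordConnected.uIcc_subset hx hy
  have h1 : ∀ w ∈ Set.uIcc x y,
      HasDerivAt (fun z => A z - z * deriv A x) (deriv A w - deriv A x) w := fun w hw => by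
    have := (hd w (hseg hw)).hasDerivAt.sub ((hasDerivAt_id w).mul_const (deriv A x))
    rwa [one_mul] at this
  have h2 := (convex_uIcc x y).norm_image_sub_le_of_norm_hasDerivWithin_le (C := K * |y - x|)
    (fun w hw => (h1 w hw).hasDerivWithinAt) (fun w hw => by
      rw [Real.norm_eq_abs]
      exact (hlip w (hseg hw)).trans
        (mul_le_mul_of_nonneg_left (Set.abs_sub_left_of_mem_uIcc hw) hK0))
    Set.left_mem_uIcc Set.right_mem_uIcc
  have h3 := (le_abs_self _).trans h2
  simp only [Real.norm_eq_abs] at h3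
  have h4 : K * |y - x| * |y - x| = K * (y - x) ^ 2 := by rw [mul_assoc, ← sq, sq_abs]
  linarith

variable {μ : Measure ℝ} {h T A : ℝ → ℝ}

lemma measurable_expFamDensity (hmh : Measurable h) (hmT : Measurable T) (θ : ℝ) :
    Measurable (expFamDensity h T A θ) := by
  unfold expFamDensity
  fun_prop

/-- Exponential tilting moves one member of an exponential family to another. -/
lemma lintegral_exp_tilt (hhpos : ∀ y, 0 ≤ h y) (hmh : Measurable h) (hmT : Measurable T)
    {θ θ' : ℝ} (hprob : IsProbabilityMeasure (expFamMeasure μ h T A θ')) :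
    ∫⁻ y, ENNReal.ofReal (Real.exp ((θ' - θ) * T y - (A θ' - A θ))) ∂(expFamMeasure μ h T A θ)
      = 1 := by
  have hm := measurable_expFamDensity (A := A) hmh hmT θ
  rw [expFamMeasure, lintegral_withDensity_eq_lintegral_mul _ (by fun_prop) (by fun_prop)]
  have h1 := hprob.measure_univ
  rw [expFamMeasure, withDensity_apply _ MeasurableSet.univ, Measure.restrict_univ] at h1
  rw [← h1]
  refine lintegral_congr fun y => ?_
  rw [Pi.mul_apply, ← ENNReal.ofReal_mul (by unfold expFamDensity; have := hhpos y; positivity)]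
  congr 1
  rw [expFamDensity, expFamDensity, mul_assoc, ← Real.exp_add]
  ring_nf

variable {domA : Set ℝ}

lemma exp_tilt_moments (hhpos : ∀ y, 0 ≤ h y) (hmh : Measurable h) (hmT : Measurable T)
    (hprob : ∀ θ ∈ domA, IsProbabilityMeasure (expFamMeasure μ h T A θ)) {θ t : ℝ}
    (ht : θ + t ∈ domA) :
    Integrable (fun y => Real.exp (t * T y)) (expFamMeasure μ h T A θ) ∧
      ProbabilityTheory.cgf T (expFamMeasure μ h T A θ) t = A (θ + t) - A θ := by
  have h1 := lintegral_exp_tilt (θ := θ) (θ' := θ + t) hhpos hmh hmT (hprob _ ht)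
  simp only [add_sub_cancel_left] at h1
  have h2 : Integrable (fun y => Real.exp (t * T y - (A (θ + t) - A θ)))
      (expFamMeasure μ h T A θ) := by
    refine ⟨by fun_prop, ?_⟩
    rw [hasFiniteIntegral_iff_ofReal (ae_of_all _ fun y => (Real.exp_pos _).le), h1]
    exact ENNReal.one_lt_top
  have h3 : (fun y => Real.exp (t * T y)) = fun y =>
      Real.exp (A (θ + t) - A θ) * Real.exp (t * T y - (A (θ + t) - A θ)) := by
    ext y
    rw [← Real.exp_add]
    ring_nf
  refine ⟨h3 ▸ h2.const_mul _, ?_⟩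
  have h4 : ∫ y, Real.exp (t * T y - (A (θ + t) - A θ)) ∂(expFamMeasure μ h T A θ) = 1 := by
    rw [integral_eq_lintegral_of_nonneg_ae (ae_of_all _ fun y => (Real.exp_pos _).le)
      (by fun_prop), h1, ENNReal.toReal_one]
  rw [ProbabilityTheory.cgf, ProbabilityTheory.mgf, h3, integral_const_mul, h4, mul_one,
    Real.log_exp]

/-- Mean and variance of the sufficient statistic are the first two derivatives of the
log-partition function. -/
lemma mean_variance_expFam (hhpos : ∀ y, 0 ≤ h y) (hmh : Measurable h) (hmT : Measurable T)
    (hprob : ∀ θ ∈ domA, IsProbabilityMeasure (expFamMeasure μ h T A θ)) {θ : ℝ}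
    (hθ : θ ∈ interior domA) :
    ∫ y, T y ∂(expFamMeasure μ h T A θ) = deriv A θ ∧
      Integrable (fun y => (T y - deriv A θ) ^ 2) (expFamMeasure μ h T A θ) ∧
      ∫ y, (T y - deriv A θ) ^ 2 ∂(expFamMeasure μ h T A θ) = deriv (deriv A) θ := by
  have hP := hprob θ (interior_subset hθ)
  set P := expFamMeasure μ h T A θ with hPdef
  have hev : ∀ᶠ t in nhds (0 : ℝ), θ + t ∈ domA := by
    have hc : Tendsto (fun t : ℝ => θ + t) (nhds 0) (nhds θ) := by
      simpa using (continuous_const.add continuous_id).tendsto (0 : ℝ) (f := fun t : ℝ => θ + t)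
    exact hc.eventually (mem_interior_iff_mem_nhds.1 hθ)
  have hint : (0 : ℝ) ∈ interior (ProbabilityTheory.integrableExpSet T P) := by
    rw [mem_interior_iff_mem_nhds]
    filter_upwards [hev] with t ht using (exp_tilt_moments hhpos hmh hmT hprob ht).1
  have hcgf : ProbabilityTheory.cgf T P =ᶠ[nhds 0] fun t => A (θ + t) - A θ := by
    filter_upwards [hev] with t ht using (exp_tilt_moments hhpos hmh hmT hprob ht).2
  have hd1 : deriv (fun t => A (θ + t) - A θ) = fun t => deriv A (θ + t) := by
    ext t
    rw [deriv_sub_const, deriv_comp_const_add]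
  have hm := ProbabilityTheory.deriv_cgf_zero hint
  rw [hcgf.deriv_eq, hd1] at hm
  simp only [add_zero, probReal_univ, div_one] at hm
  have hv := ProbabilityTheory.iteratedDeriv_two_cgf_eq_integral hint
  rw [hcgf.deriv_eq, hd1, iteratedDeriv_succ, iteratedDeriv_one,
    hcgf.deriv.deriv_eq, hd1, deriv_comp_const_add] at hv
  simp only [add_zero, zero_mul, Real.exp_zero, mul_one, div_one,
    ProbabilityTheory.mgf_zero] at hv
  have hL : MemLp T 2 P := by
    simpa using ProbabilityTheory.memLp_of_mem_interior_integrableExpSet hint 2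
  exact ⟨hm.symm, (hL.sub (memLp_const (deriv A θ))).integrable_sq, hv.symm⟩

/-- The sufficient statistic has mean absolute deviation at most its standard deviation bound. -/
lemma lintegral_abs_sub_mean_le (hhpos : ∀ y, 0 ≤ h y) (hmh : Measurable h) (hmT : Measurable T)
    (hprob : ∀ θ ∈ domA, IsProbabilityMeasure (expFamMeasure μ h T A θ)) {θ : ℝ}
    (hθ : θ ∈ interior domA) {M0 : ℝ} (hM0 : 0 < M0) (hA : deriv (deriv A) θ ≤ M0 ^ 2 / 2) :
    ∫⁻ y, ENNReal.ofReal |T y - ∫ z, T z ∂(expFamMeasure μ h T A θ)| ∂(expFamMeasure μ h T A θ)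
      ≤ ENNReal.ofReal M0 := by
  obtain ⟨h1, h2, h3⟩ := mean_variance_expFam hhpos hmh hmT hprob hθ
  have hP := hprob θ (interior_subset hθ)
  rw [h1]
  have hi : Integrable (fun y => (T y - deriv A θ) ^ 2 / (2 * M0) + M0 / 2)
      (expFamMeasure μ h T A θ) := (h2.div_const _).add (integrable_const _)
  calc _ ≤ ∫⁻ y, ENNReal.ofReal ((T y - deriv A θ) ^ 2 / (2 * M0) + M0 / 2)
        ∂(expFamMeasure μ h T A θ) := by
        refine lintegral_mono fun y => ENNReal.ofReal_le_ofReal ?_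
        rw [← sq_abs]
        have : (|T y - deriv A θ| ^ 2 / (2 * M0) + M0 / 2) - |T y - deriv A θ|
            = (|T y - deriv A θ| - M0) ^ 2 / (2 * M0) := by
          field_simp
          ring
        have h0 : 0 ≤ (|T y - deriv A θ| - M0) ^ 2 / (2 * M0) := by positivity
        linarith
    _ = ENNReal.ofReal (∫ y, (T y - deriv A θ) ^ 2 / (2 * M0) + M0 / 2
        ∂(expFamMeasure μ h T A θ)) :=
        (ofReal_integral_eq_lintegral_ofReal hi (ae_of_all _ fun y => by positivity)).symm
    _ ≤ ENNReal.ofReal M0 := by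
        refine ENNReal.ofReal_le_ofReal ?_
        rw [integral_add (h2.div_const _) (integrable_const _), integral_div, h3]
        simp only [integral_const, probReal_univ, one_smul]
        have : deriv (deriv A) θ / (2 * M0) ≤ M0 / 4 := by
          rw [div_le_iff₀ (by positivity)]
          linarith
        linarith

end ExponentialFamily

section Data

/-- Tonelli's theorem for a product of functions of the coordinates. -/
lemma lintegral_pi_prod {n : ℕ} (ν : Fin n → Measure ℝ) [∀ i, SigmaFinite (ν i)]
    {f : Fin n → ℝ → ENNReal} (hf : ∀ i, Measurable (f i)) :
    ∫⁻ x, ∏ i, f i (x i) ∂(Measure.pi ν) = ∏ i, ∫⁻ x, f i x ∂(ν i) := by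
  induction n with
  | zero => simp
  | succ n ih =>
    have hg : Measurable fun x : Fin n → ℝ => ∏ i, f i.succ (x i) :=
      Finset.measurable_prod _ fun i _ => (hf i.succ).comp (measurable_pi_apply i)
    rw [← ((measurePreserving_piFinSuccAbove ν 0).symm).lintegral_comp_emb
      (MeasurableEquiv.measurableEmbedding _), Fin.prod_univ_succ, ← ih _ fun i => hf i.succ,
      ← lintegral_prod_mul (hf 0).aemeasurable hg.aemeasurable]
    refine lintegral_congr fun x => ?_
    simp [Fin.prod_univ_succ, MeasurableEquiv.piFinSuccAbove_symm_apply, Fin.insertNthEquiv]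

variable {μ : Measure ℝ} {h T A ηf : ℝ → ℝ} {domA : Set ℝ}

/-- The likelihood ratio has expectation one under the true parameter. -/
lemma lintegral_exp_logLR (hhpos : ∀ y, 0 ≤ h y) (hmh : Measurable h) (hmT : Measurable T)
    (hprob : ∀ θ ∈ domA, IsProbabilityMeasure (expFamMeasure μ h T A θ))
    (hη : ∀ t, ηf t ∈ interior domA) {n dn : ℕ} (X : Matrix (Fin n) (Fin dn) ℝ)
    (βs β : Fin dn → ℝ) :
    ∫⁻ y, ENNReal.ofReal (Real.exp (logLR μ h T A ηf X βs β y))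
      ∂(dataMeasure μ h T A n (etaVec ηf X βs)) = 1 := by
  have hP : ∀ i, IsProbabilityMeasure (expFamMeasure μ h T A (etaVec ηf X βs i)) :=
    fun i => hprob _ (interior_subset (hη _))
  have h1 : ∀ y, ENNReal.ofReal (Real.exp (logLR μ h T A ηf X βs β y)) =
      ∏ i, ENNReal.ofReal (Real.exp ((etaVec ηf X β i - etaVec ηf X βs i) * T (y i)
        - (A (etaVec ηf X β i) - A (etaVec ηf X βs i)))) := fun y => by
    rw [← ENNReal.ofReal_prod_of_nonneg fun i _ => (Real.exp_pos _).le, ← Real.exp_sum]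
    congr 2
    rw [logLR, centeredZ, klDiv, ← Finset.sum_sub_distrib]
    refine Finset.sum_congr rfl fun i _ => ?_
    rw [(mean_variance_expFam hhpos hmh hmT hprob (θ := etaVec ηf X βs i) (hη _)).1]
    ring
  simp_rw [h1]
  refine (lintegral_pi_prod (f := fun i z => ENNReal.ofReal (Real.exp
    ((etaVec ηf X β i - etaVec ηf X βs i) * T z - (A (etaVec ηf X β i) - A (etaVec ηf X βs i)))))
    _ fun i => by fun_prop).trans ?_
  exact Finset.prod_eq_one fun i _ =>
    lintegral_exp_tilt hhpos hmh hmT (hprob _ (interior_subset (hη _)))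

/-- The total absolute noise `∑ |T(y_i) - E T(y_i)|`. -/
def absNoise (μ : Measure ℝ) (h T A : ℝ → ℝ) {n : ℕ} (θ : Fin n → ℝ) (y : Fin n → ℝ) : ℝ :=
  ∑ i, |T (y i) - ∫ z, T z ∂(expFamMeasure μ h T A (θ i))|

lemma measurable_absNoise (hmT : Measurable T) {n : ℕ} (θ : Fin n → ℝ) :
    Measurable (absNoise μ h T A θ) := by
  unfold absNoise
  fun_prop

lemma measure_absNoise_gt_le (hhpos : ∀ y, 0 ≤ h y) (hmh : Measurable h) (hmT : Measurable T)
    (hprob : ∀ θ ∈ domA, IsProbabilityMeasure (expFamMeasure μ h T A θ))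
    {M0 : ℝ} (hM0 : 0 < M0) {n : ℕ} {θ : Fin n → ℝ} (hθ : ∀ i, θ i ∈ interior domA)
    (hA : ∀ i, deriv (deriv A) (θ i) ≤ M0 ^ 2 / 2) {t : ℝ} (ht : 0 < t) :
    dataMeasure μ h T A n θ {y | t < absNoise μ h T A θ y} ≤ ENNReal.ofReal (n * M0 / t) := by
  have hP : ∀ i, IsProbabilityMeasure (expFamMeasure μ h T A (θ i)) :=
    fun i => hprob _ (interior_subset (hθ i))
  have hmean : ∫⁻ y, ENNReal.ofReal (absNoise μ h T A θ y) ∂(dataMeasure μ h T A n θ)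
      ≤ ENNReal.ofReal (n * M0) := by
    have h1 : ∀ y, ENNReal.ofReal (absNoise μ h T A θ y) =
        ∑ i, ENNReal.ofReal |T (y i) - ∫ z, T z ∂(expFamMeasure μ h T A (θ i))| :=
      fun y => ENNReal.ofReal_sum_of_nonneg fun i _ => abs_nonneg _
    simp_rw [h1]
    rw [lintegral_finsetSum _ fun i _ => by fun_prop, ENNReal.ofReal_mul (by positivity),
      ENNReal.ofReal_natCast]
    calc _ ≤ ∑ i : Fin n, ENNReal.ofReal M0 := Finset.sum_le_sum fun i _ => by
          have h2 := (measurePreserving_eval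
            (fun i => expFamMeasure μ h T A (θ i)) i).lintegral_comp (f := fun z =>
              ENNReal.ofReal |T z - ∫ z, T z ∂(expFamMeasure μ h T A (θ i))|) (by fun_prop)
          simp only [Function.eval] at h2
          rw [dataMeasure, h2]
          exact lintegral_abs_sub_mean_le hhpos hmh hmT hprob (hθ i) hM0 (hA i)
      _ = n * ENNReal.ofReal M0 := by simp
  have hmarkov := meas_ge_le_lintegral_div (μ := dataMeasure μ h T A n θ)
    (measurable_absNoise (μ := μ) (h := h) (A := A) hmT θ).ennreal_ofReal.aemeasurable
    (ε := ENNReal.ofReal t) (by simpa using ht) ENNReal.ofReal_ne_top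
  calc _ ≤ _ := measure_mono fun y (hy : t < _) => ENNReal.ofReal_le_ofReal hy.le
    _ ≤ _ := hmarkov
    _ ≤ ENNReal.ofReal (n * M0) / ENNReal.ofReal t := by gcongr
    _ = _ := (ENNReal.ofReal_div_of_pos ht).symm

lemma measurable_logLR (hmT : Measurable T) (hη : Measurable ηf)
    (hAη : Measurable fun t => A (ηf t)) {n dn : ℕ} (X : Matrix (Fin n) (Fin dn) ℝ)
    (βs : Fin dn → ℝ) :
    Measurable fun p : (Fin dn → ℝ) × (Fin n → ℝ) => logLR μ h T A ηf X βs p.1 p.2 := by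
  have h1 : ∀ i, Measurable fun p : (Fin dn → ℝ) × (Fin n → ℝ) => ∑ j, X i j * p.1 j :=
    fun i => by fun_prop
  have h2 : ∀ i, Measurable fun p : (Fin dn → ℝ) × (Fin n → ℝ) => etaVec ηf X p.1 i :=
    fun i => hη.comp (h1 i)
  have h3 : ∀ i, Measurable fun p : (Fin dn → ℝ) × (Fin n → ℝ) => A (etaVec ηf X p.1 i) :=
    fun i => hAη.comp (h1 i)
  have h4 : ∀ i, Measurable fun p : (Fin dn → ℝ) × (Fin n → ℝ) => T (p.2 i) := fun i => by fun_prop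
  exact (Finset.measurable_sum _ fun i _ => ((h4 i).sub_const _).mul ((h2 i).sub_const _)).sub
    (Finset.measurable_sum _ fun i _ => ((h3 i).sub_const _).sub
      (((h2 i).sub_const _).mul_const _))

end Data

section Prior

lemma lintegral_exp_neg_mul_abs_le {c : ℝ} (hc : 0 < c) :
    ∫⁻ x : ℝ, ENNReal.ofReal (Real.exp (-(c * |x|))) ≤ ENNReal.ofReal (2 / c) := by
  have h1 : ∫⁻ x in Set.Iic (0 : ℝ), ENNReal.ofReal (Real.exp (-(c * |x|)))
      = ENNReal.ofReal (1 / c) := by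
    rw [setLIntegral_congr_fun (g := fun x => ENNReal.ofReal (Real.exp (c * x)))
      measurableSet_Iic fun x (hx : x ≤ 0) => by simp [abs_of_nonpos hx],
      ← ofReal_integral_eq_lintegral_ofReal (integrableOn_exp_mul_Iic hc 0)
        (ae_of_all _ fun x => (Real.exp_pos _).le), integral_exp_mul_Iic hc]
    simp
  have h2 : ∫⁻ x in Set.Ioi (0 : ℝ), ENNReal.ofReal (Real.exp (-(c * |x|)))
      = ENNReal.ofReal (1 / c) := by
    rw [setLIntegral_congr_fun (g := fun x => ENNReal.ofReal (Real.exp (-c * x)))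
      measurableSet_Ioi fun x (hx : 0 < x) => by simp [abs_of_pos hx],
      ← ofReal_integral_eq_lintegral_ofReal (integrableOn_exp_mul_Ioi (neg_lt_zero.2 hc) 0)
        (ae_of_all _ fun x => (Real.exp_pos _).le), integral_exp_mul_Ioi (neg_lt_zero.2 hc)]
    simp
  calc _ = ∫⁻ x in Set.Iic (0 : ℝ) ∪ Set.Ioi 0, ENNReal.ofReal (Real.exp (-(c * |x|))) := by
        rw [Set.Iic_union_Ioi, Measure.restrict_univ]
    _ ≤ _ := lintegral_union_le _ _ _
    _ = _ := by
        rw [h1, h2, ← ENNReal.ofReal_add (by positivity) (by positivity)]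
        ring_nf

lemma lintegral_laplace_le {lam : ℝ} (hlam : 0 < lam) (c : ℝ) :
    ∫⁻ x, ENNReal.ofReal (Real.exp (lam * |x| - lam / 2 * |x - c|)) ∂(laplaceMeasure lam)
      ≤ 2 := by
  rw [laplaceMeasure, lintegral_withDensity_eq_lintegral_mul _ (by fun_prop) (by fun_prop)]
  calc _ = ∫⁻ x : ℝ, ENNReal.ofReal (lam / 2) *
        ENNReal.ofReal (Real.exp (-(lam / 2 * |x - c|))) := by
        refine lintegral_congr fun x => ?_
        rw [Pi.mul_apply, ← ENNReal.ofReal_mul (by positivity),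
          ← ENNReal.ofReal_mul (by positivity), mul_assoc, ← Real.exp_add]
        ring_nf
    _ = ENNReal.ofReal (lam / 2) * ∫⁻ x : ℝ, ENNReal.ofReal (Real.exp (-(lam / 2 * |x|))) := by
        rw [lintegral_const_mul _ (by fun_prop),
          lintegral_sub_right_eq_self (fun x => ENNReal.ofReal (Real.exp (-(lam / 2 * |x|)))) c]
    _ ≤ ENNReal.ofReal (lam / 2) * ENNReal.ofReal (2 / (lam / 2)) := by
        gcongr
        exact lintegral_exp_neg_mul_abs_le (by positivity)
    _ = 2 := by
        rw [← ENNReal.ofReal_mul (by positivity), mul_div_cancel₀ _ (by positivity)]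
        simp

lemma le_laplaceMeasure_Icc {lam : ℝ} (hlam : 0 < lam) (c ρ : ℝ) :
    ENNReal.ofReal (lam * ρ * Real.exp (-(lam * ρ)) * Real.exp (-(lam * |c|)))
      ≤ laplaceMeasure lam (Set.Icc (c - ρ) (c + ρ)) := by
  rw [laplaceMeasure, withDensity_apply _ measurableSet_Icc]
  calc _ = ∫⁻ _ in Set.Icc (c - ρ) (c + ρ),
        ENNReal.ofReal (lam / 2 * Real.exp (-(lam * (|c| + ρ)))) := by
        rw [setLIntegral_const, Real.volume_Icc, ← ENNReal.ofReal_mul (by positivity), mul_assoc,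
          ← Real.exp_add]
        ring_nf
    _ ≤ _ := by
        refine setLIntegral_mono' measurableSet_Icc fun x hx => ENNReal.ofReal_le_ofReal ?_
        have h1 : |x| ≤ |c| + ρ := by
          have h2 : |x - c| ≤ ρ := abs_le.2 ⟨by linarith [hx.1], by linarith [hx.2]⟩
          linarith [abs_sub_abs_le_abs_sub x c]
        gcongr

instance sigmaFinite_model {dn : ℕ} (lam : ℝ) (S : Finset (Fin dn)) (j : Fin dn) :
    SigmaFinite (if j ∈ S then laplaceMeasure lam else Measure.dirac 0) := by
  split_ifs
  · exact SigmaFinite.withDensity_ofReal _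
  · infer_instance

lemma lintegral_modelMeasure_le {dn : ℕ} {lam : ℝ} (hlam : 0 < lam) (S : Finset (Fin dn))
    (c : Fin dn → ℝ) :
    ∫⁻ β, ENNReal.ofReal (Real.exp (lam * l1 β - lam / 2 * l1 (β - c))) ∂(modelMeasure dn lam S)
      ≤ 2 ^ S.card := by
  have h1 : ∀ β : Fin dn → ℝ, ENNReal.ofReal (Real.exp (lam * l1 β - lam / 2 * l1 (β - c)))
      = ∏ j, ENNReal.ofReal (Real.exp (lam * |β j| - lam / 2 * |β j - c j|)) := fun β => by
    rw [← ENNReal.ofReal_prod_of_nonneg fun i _ => (Real.exp_pos _).le, ← Real.exp_sum, l1, l1,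
      Finset.mul_sum, Finset.mul_sum, ← Finset.sum_sub_distrib]
    rfl
  simp_rw [h1]
  calc _ = ∏ j, ∫⁻ x, ENNReal.ofReal (Real.exp (lam * |x| - lam / 2 * |x - c j|))
        ∂(if j ∈ S then laplaceMeasure lam else Measure.dirac 0) :=
        lintegral_pi_prod (f := fun j x =>
          ENNReal.ofReal (Real.exp (lam * |x| - lam / 2 * |x - c j|))) _ fun j => by fun_prop
    _ ≤ ∏ j, if j ∈ S then 2 else 1 := Finset.prod_le_prod' fun j _ => by
        split_ifs
        · exact lintegral_laplace_le hlam _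
        · rw [lintegral_dirac, ← ENNReal.ofReal_one]
          refine ENNReal.ofReal_le_ofReal (Real.exp_le_one_iff.2 ?_)
          have := mul_nonneg hlam.le (abs_nonneg (0 - c j))
          rw [abs_zero]
          linarith
    _ = 2 ^ S.card := by simp [Finset.prod_ite_mem]

lemma le_modelMeasure_box {dn : ℕ} {lam : ℝ} (hlam : 0 < lam) (c : Fin dn → ℝ) {ρ : ℝ}
    (hρ : 0 < ρ) :
    ENNReal.ofReal ((lam * ρ * Real.exp (-(lam * ρ))) ^ (suppSet c).card *
        Real.exp (-(lam * l1 c)))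
      ≤ modelMeasure dn lam (suppSet c) (Set.univ.pi fun j => Set.Icc (c j - ρ) (c j + ρ)) := by
  rw [modelMeasure, Measure.pi_pi]
  calc _ = ∏ j, ENNReal.ofReal ((if j ∈ suppSet c then lam * ρ * Real.exp (-(lam * ρ)) else 1) *
        Real.exp (-(lam * |c j|))) := by
        rw [← ENNReal.ofReal_prod_of_nonneg fun i _ => by split_ifs <;> positivity,
          Finset.prod_mul_distrib, ← Real.exp_sum, l1, Finset.mul_sum, Finset.sum_neg_distrib]
        simp [Finset.prod_ite_mem]
    _ ≤ _ := Finset.prod_le_prod' fun j _ => by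
        split_ifs with hj
        · exact le_laplaceMeasure_Icc hlam _ _
        · have h0 : c j = 0 := by simpa [suppSet] using hj
          simp [h0, hρ.le]

/-- A model charges only vectors supported in it. -/
lemma modelMeasure_superset_eq_zero {dn : ℕ} (lam : ℝ) {S₀ S : Finset (Fin dn)}
    (hS : ¬ S₀ ⊂ S) : modelMeasure dn lam S {β | S₀ ⊂ suppSet β} = 0 := by
  have hsub : {β : Fin dn → ℝ | S₀ ⊂ suppSet β} ⊆
      ⋃ j ∈ Sᶜ, Function.eval j ⁻¹' ({0}ᶜ : Set ℝ) := by
    intro β hβ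
    have h1 : ¬ suppSet β ⊆ S := fun hle => hS (hβ.trans_le hle)
    obtain ⟨j, hj, hjS⟩ := Finset.not_subset.1 h1
    simp only [Set.mem_iUnion]
    exact ⟨j, by simpa using hjS, by simpa [suppSet] using hj⟩
  refine measure_mono_null hsub ((measure_biUnion_null_iff (Finset.countable_toSet _)).2
    fun j hj => ?_)
  refine Measure.pi_eval_preimage_null _ ?_
  rw [if_neg (by simpa using hj)]
  simp

lemma sum_ssuperset_pow_le {dn : ℕ} (S₀ : Finset (Fin dn)) {q : ℝ} (hq : 0 ≤ q) :
    ∑ S with S₀ ⊂ S, q ^ (S.card - S₀.card) ≤ Real.exp (dn * q) - 1 := by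
  have h1 : ∑ T : Finset (Fin dn), q ^ T.card = (q + 1) ^ dn := by
    simpa using Fintype.sum_pow_mul_eq_add_pow (Fin dn) q 1
  have h2 : ∑ T with T ≠ (∅ : Finset (Fin dn)), q ^ T.card = (q + 1) ^ dn - 1 := by
    rw [Finset.filter_ne', ← h1, ← Finset.add_sum_erase _ _ (Finset.mem_univ ∅)]
    simp
  have h3 : ∑ S with S₀ ⊂ S, q ^ (S.card - S₀.card) ≤
      ∑ T with T ≠ (∅ : Finset (Fin dn)), q ^ T.card := by
    have hinj : Set.InjOn (fun S => S \ S₀) ({S | S₀ ⊂ S} : Finset (Finset (Fin dn))) := by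
      intro S hS S' hS' he
      simp only [Finset.coe_filter, Finset.mem_univ, true_and, Set.mem_ofPred_eq] at hS hS'
      rw [← Finset.sdiff_union_of_subset hS.1, ← Finset.sdiff_union_of_subset hS'.1]
      exact congrArg (· ∪ S₀) he
    calc _ = ∑ S with S₀ ⊂ S, q ^ (S \ S₀).card := Finset.sum_congr rfl fun S hS => by
          rw [Finset.card_sdiff_of_subset (Finset.mem_filter.1 hS).2.1]
      _ = ∑ T ∈ ({S | S₀ ⊂ S} : Finset (Finset (Fin dn))).image (fun S => S \ S₀), q ^ T.card :=
          (Finset.sum_image (f := fun T : Finset (Fin dn) => q ^ T.card) hinj).symm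
      _ ≤ _ := by
          refine Finset.sum_le_sum_of_subset_of_nonneg ?_ fun _ _ _ => by positivity
          intro T hT
          obtain ⟨S, hS, rfl⟩ := Finset.mem_image.1 hT
          simp only [Finset.mem_filter, Finset.mem_univ, true_and] at hS ⊢
          rw [Ne, Finset.sdiff_eq_empty_iff_subset]
          exact hS.2
  have h4 : (q + 1) ^ dn ≤ Real.exp (dn * q) := by
    rw [Real.exp_nat_mul]
    exact pow_le_pow_left₀ (by positivity) (Real.add_one_le_exp q) _
  linarith

end Prior

section Posterior

/-- Bound for the expected value of a ratio of integrals, as in a posterior probability. -/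
lemma lintegral_ratio_le {α Ω : Type*} [MeasurableSpace α] [MeasurableSpace Ω]
    (ν : Measure α) [SFinite ν] (P : Measure Ω) [IsProbabilityMeasure P] {f : α → Ω → ℝ}
    (hf0 : ∀ a y, 0 ≤ f a y) (hfm : Measurable fun p : α × Ω => f p.1 p.2)
    (hf1 : ∀ a, ∫⁻ y, ENNReal.ofReal (f a y) ∂P ≤ 1) (B : Set α) {g : α → ENNReal}
    (hg : Measurable g) {G c ε₁ ε₂ : ENNReal} {W : Set Ω} (hW : MeasurableSet W)
    (hPW : P Wᶜ ≤ ε₁) (hc0 : c ≠ 0) (hc : c ≠ ⊤)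
    (hlow : ∀ y ∈ W, c ≤ ∫⁻ a, ENNReal.ofReal (f a y) ∂ν)
    (hup : ∀ y ∈ W, ∀ a, ENNReal.ofReal (f a y) ≤ g a * (G * ENNReal.ofReal (f a y) + 1))
    (hε : (∫⁻ a in B, g a ∂ν) * (G + 1) ≤ ε₂ * c) :
    ∫⁻ y, ENNReal.ofReal ((∫ a in B, f a y ∂ν) / ∫ a, f a y ∂ν) ∂P ≤ ε₁ + ε₂ := by
  have hfm' : Measurable fun p : Ω × α => f p.2 p.1 := hfm.comp measurable_swap
  have hfa : ∀ y, Measurable fun a => f a y := fun y => hfm.comp measurable_prodMk_right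
  have hfy : ∀ a, Measurable fun y => f a y := fun a => hfm.comp measurable_prodMk_left
  have hle1 : ∀ y, ENNReal.ofReal ((∫ a in B, f a y ∂ν) / ∫ a, f a y ∂ν) ≤ 1 := fun y => by
    rw [ENNReal.ofReal_le_one]
    by_cases hi : Integrable (fun a => f a y) ν
    · exact div_le_one_of_le₀ (setIntegral_le_integral hi (ae_of_all _ fun a => hf0 a y))
        (integral_nonneg fun a => hf0 a y)
    · simp [integral_undef hi]
  have hle : ∀ y ∈ W, ENNReal.ofReal ((∫ a in B, f a y ∂ν) / ∫ a, f a y ∂ν) ≤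
      c⁻¹ * ∫⁻ a in B, g a * (G * ENNReal.ofReal (f a y) + 1) ∂ν := fun y hy => by
    by_cases hi : Integrable (fun a => f a y) ν
    · have hpos : 0 < ∫ a, f a y ∂ν := by
        rw [← ENNReal.ofReal_pos,
          ofReal_integral_eq_lintegral_ofReal hi (ae_of_all _ fun a => hf0 a y)]
        exact (pos_iff_ne_zero.2 hc0).trans_le (hlow y hy)
      rw [ENNReal.ofReal_div_of_pos hpos,
        ofReal_integral_eq_lintegral_ofReal hi (ae_of_all _ fun a => hf0 a y),
        ofReal_integral_eq_lintegral_ofReal hi.integrableOn (ae_of_all _ fun a => hf0 a y),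
        div_eq_mul_inv, mul_comm]
      exact mul_le_mul' (ENNReal.inv_le_inv.2 (hlow y hy)) (lintegral_mono fun a => hup y hy a)
    · simp [integral_undef hi]
  rw [← lintegral_add_compl _ hW, add_comm ε₁]
  refine add_le_add ?_ ?_
  · calc _ ≤ ∫⁻ y in W, c⁻¹ * ∫⁻ a in B, g a * (G * ENNReal.ofReal (f a y) + 1) ∂ν ∂P :=
          setLIntegral_mono' hW hle
      _ ≤ ∫⁻ y, c⁻¹ * ∫⁻ a in B, g a * (G * ENNReal.ofReal (f a y) + 1) ∂ν ∂P :=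
          setLIntegral_le_lintegral _ _
      _ = c⁻¹ * ∫⁻ a in B, ∫⁻ y, g a * (G * ENNReal.ofReal (f a y) + 1) ∂P ∂ν := by
          rw [lintegral_const_mul' _ _ (ENNReal.inv_ne_top.2 hc0), lintegral_lintegral_swap]
          exact Measurable.aemeasurable (by fun_prop)
      _ ≤ c⁻¹ * ∫⁻ a in B, g a * (G + 1) ∂ν := by
          refine mul_le_mul' le_rfl (lintegral_mono fun a => ?_)
          have hm := (hfy a).ennreal_ofReal
          rw [lintegral_const_mul _ (by fun_prop), lintegral_add_right _ measurable_const,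
            lintegral_const_mul _ hm]
          refine mul_le_mul' le_rfl (add_le_add ?_ (by simp))
          exact (mul_le_mul' le_rfl (hf1 a)).trans_eq (mul_one G)
      _ ≤ c⁻¹ * (ε₂ * c) := by
          rw [lintegral_mul_const _ hg]
          exact mul_le_mul' le_rfl hε
      _ = ε₂ := by
          rw [mul_comm ε₂, ← mul_assoc, ENNReal.inv_mul_cancel hc0 hc, one_mul]
  · calc _ ≤ ∫⁻ _ in Wᶜ, 1 ∂P := lintegral_mono fun y => hle1 y
      _ ≤ ε₁ := by simpa using hPW

lemma integral_le_of_lintegral_ofReal_le {Ω : Type*} [MeasurableSpace Ω] {P : Measure Ω}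
    {p : Ω → ℝ} (hp : ∀ y, 0 ≤ p y) {ε : ℝ} (hε : 0 ≤ ε)
    (h : ∫⁻ y, ENNReal.ofReal (p y) ∂P ≤ ENNReal.ofReal ε) : ∫ y, p y ∂P ≤ ε := by
  by_cases hm : AEStronglyMeasurable p P
  · rw [integral_eq_lintegral_of_nonneg_ae (ae_of_all _ hp) hm]
    exact ENNReal.toReal_le_of_le_ofReal hε h
  · rwa [integral_non_aestronglyMeasurable hm]

/-- Case analysis behind the pointwise upper bound for the likelihood ratio: either the
prior exponent `E` is not too small, or the divergence `D` dominates. -/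
lemma exp_le_exp_mul_of_divergence {L D E u v lam K N κ τ g : ℝ} (hu : 0 ≤ u) (hv : 0 ≤ v)
    (hlam : 0 ≤ lam) (hK : lam ≤ K) (hN : 1 ≤ N) (hL : L ≤ N * K * (u + v) - D)
    (hE : lam / 2 * (v - 3 * u) ≤ E) (hD : 0 < u → v < 7 * u → κ * u ^ 2 ≤ D) (hκ : 0 ≤ κ)
    (hτ0 : 0 ≤ τ) (hκτ : 10 * (N * K) ≤ κ * τ) (hτ : 3 / 2 * K * τ ≤ g) :
    Real.exp L ≤ Real.exp E * (Real.exp g * Real.exp L + 1) := by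
  have hK0 : 0 ≤ K := hlam.trans hK
  have hlarge : 0 ≤ E + g → Real.exp L ≤ Real.exp E * (Real.exp g * Real.exp L + 1) := fun h0 => by
    have h1 : Real.exp L ≤ Real.exp (E + g) * Real.exp L :=
      le_mul_of_one_le_left (Real.exp_pos _).le (Real.one_le_exp h0)
    rw [Real.exp_add] at h1
    nlinarith [Real.exp_pos E]
  have hg : 0 ≤ g := le_trans (by positivity) hτ
  rcases le_or_gt (3 * u) v with h3 | h3
  · have := mul_nonneg hlam (sub_nonneg.2 h3)
    exact hlarge (by linarith)
  rcases le_or_gt u τ with h4 | h4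
  · have h5 : lam * u ≤ K * τ := mul_le_mul hK h4 hu hK0
    have h6 := mul_nonneg hlam hv
    exact hlarge (by linarith)
  · have hu' : 0 < u := hτ0.trans_lt h4
    have h5 : κ * τ * u ≤ κ * u ^ 2 := by
      rw [pow_two, ← mul_assoc]
      gcongr
    have h6 : 10 * (N * K) * u ≤ κ * τ * u := by gcongr
    have h7 := hD hu' (by linarith)
    have hNK : 0 ≤ N * K := by positivity
    have h8 : N * K * (u + v) ≤ N * K * (4 * u) := by
      gcongr
      linarith
    have h9 : lam * u ≤ N * K * u := by
      gcongr
      nlinarith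
    have h10 := mul_nonneg hlam hv
    have h11 := mul_nonneg hNK hu
    have h12 : L ≤ E := by linarith
    have h13 : Real.exp L ≤ Real.exp E := Real.exp_le_exp.2 h12
    nlinarith [mul_pos (Real.exp_pos E) (mul_pos (Real.exp_pos g) (Real.exp_pos L))]

end Posterior

section Vectors

lemma l1_nonneg {m : ℕ} (v : Fin m → ℝ) : 0 ≤ l1 v := Finset.sum_nonneg fun _ _ => abs_nonneg _

lemma restr_sub {m : ℕ} (S : Finset (Fin m)) (v w : Fin m → ℝ) :
    restr S (v - w) = restr S v - restr S w := by
  ext j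
  simp only [restr, Pi.sub_apply]
  split_ifs <;> simp

lemma l1_restr {m : ℕ} (S : Finset (Fin m)) (v : Fin m → ℝ) : l1 (restr S v) = ∑ j ∈ S, |v j| := by
  simp [l1, restr, apply_ite abs]

lemma l1_restr_add_compl {m : ℕ} (S : Finset (Fin m)) (v : Fin m → ℝ) :
    l1 (restr S v) + l1 (restr Sᶜ v) = l1 v := by
  rw [l1_restr, l1_restr, Finset.sum_add_sum_compl, l1]

lemma l1_restr_suppSet_sub_le {m : ℕ} (v c : Fin m → ℝ) :
    l1 (restr (suppSet c)ᶜ (v - c)) - l1 (restr (suppSet c) (v - c)) ≤ l1 v - l1 c := by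
  rw [l1_restr, l1_restr, l1, l1, ← Finset.sum_add_sum_compl (suppSet c) fun j => |v j|,
    ← Finset.sum_add_sum_compl (suppSet c) fun j => |c j|]
  have h0 : ∀ j ∈ (suppSet c)ᶜ, c j = 0 := fun j hj => by simpa [suppSet] using hj
  have h1 : ∑ j ∈ (suppSet c)ᶜ, |(v - c) j| = ∑ j ∈ (suppSet c)ᶜ, |v j| :=
    Finset.sum_congr rfl fun j hj => by simp [h0 j hj]
  have h2 : ∑ j ∈ (suppSet c)ᶜ, |c j| = 0 := Finset.sum_eq_zero fun j hj => by simp [h0 j hj]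
  have h3 : ∑ j ∈ suppSet c, |c j| ≤ ∑ j ∈ suppSet c, |v j| + ∑ j ∈ suppSet c, |(v - c) j| := by
    rw [← Finset.sum_add_distrib]
    refine Finset.sum_le_sum fun j _ => ?_
    have := abs_sub_abs_le_abs_sub (c j) (v j)
    rw [abs_sub_comm] at this
    rw [Pi.sub_apply]
    linarith
  linarith

lemma abs_le_Xnorm {n dn : ℕ} (X : Matrix (Fin n) (Fin dn) ℝ) (i : Fin n) (j : Fin dn) :
    |X i j| ≤ Xnorm X :=
  (le_ciSup (f := fun j => |X i j|) (Set.finite_range _).bddAbove j).trans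
    (le_ciSup (f := fun i => ⨆ j, |X i j|) (Set.finite_range _).bddAbove i)

lemma Xnorm_nonneg {n dn : ℕ} (X : Matrix (Fin n) (Fin dn) ℝ) : 0 ≤ Xnorm X :=
  Real.iSup_nonneg fun _ => Real.iSup_nonneg fun _ => abs_nonneg _

lemma Xnorm_le_Mconst {M0 : ℝ} (hM0 : 0 < M0) {n dn : ℕ} (X : Matrix (Fin n) (Fin dn) ℝ) :
    Xnorm X ≤ Mconst M0 X := by
  refine le_mul_of_one_le_right (Xnorm_nonneg X) (one_le_inv_iff₀.2 ⟨?_, min_le_left _ _⟩)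
  exact lt_min one_pos (inv_pos.2 hM0)

lemma Xnorm_mul_le_Mconst {M0 : ℝ} (hM0 : 0 < M0) {n dn : ℕ} (X : Matrix (Fin n) (Fin dn) ℝ) :
    Xnorm X * M0 ≤ Mconst M0 X := by
  refine mul_le_mul_of_nonneg_left ?_ (Xnorm_nonneg X)
  rw [le_inv_comm₀ hM0 (lt_min one_pos (inv_pos.2 hM0))]
  exact min_le_right _ _

lemma abs_etaVec_sub_le {ηf : ℝ → ℝ} (hlip : LipschitzWith 1 ηf) {n dn : ℕ}
    (X : Matrix (Fin n) (Fin dn) ℝ) (β c : Fin dn → ℝ) (i : Fin n) :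
    |etaVec ηf X β i - etaVec ηf X c i| ≤ Xnorm X * l1 (β - c) := by
  calc _ ≤ |∑ j, X i j * β j - ∑ j, X i j * c j| := by
        simpa [Real.dist_eq, etaVec] using hlip.dist_le_mul (∑ j, X i j * β j) (∑ j, X i j * c j)
    _ = |∑ j, X i j * (β - c) j| := by
        rw [← Finset.sum_sub_distrib]
        simp [mul_sub]
    _ ≤ ∑ j, |X i j * (β - c) j| := Finset.abs_sum_le_sum_abs _ _
    _ ≤ _ := by
        rw [l1, Finset.mul_sum]
        refine Finset.sum_le_sum fun j _ => ?_
        rw [abs_mul]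
        exact mul_le_mul_of_nonneg_right (abs_le_Xnorm X i j) (abs_nonneg _)

lemma abs_centeredZ_le (μ : Measure ℝ) (h T A : ℝ → ℝ) {n : ℕ} {θ θ' : Fin n → ℝ} {K : ℝ}
    (hK : ∀ i, |θ' i - θ i| ≤ K) (y : Fin n → ℝ) :
    |centeredZ T (fun i => ∫ z, T z ∂(expFamMeasure μ h T A (θ i))) θ θ' y| ≤
      K * absNoise μ h T A θ y := by
  rw [centeredZ, absNoise, Finset.mul_sum]
  refine (Finset.abs_sum_le_sum_abs _ _).trans (Finset.sum_le_sum fun i _ => ?_)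
  rw [abs_mul, mul_comm]
  exact mul_le_mul_of_nonneg_right (hK i) (abs_nonneg _)

end Vectors

section Prior

lemma lintegral_superset_priorMeasure_le {dn : ℕ} {lam a C : ℝ} (hlam : 0 < lam) (hC : 0 ≤ C)
    (c : Fin dn → ℝ) :
    ∫⁻ β in {β | suppSet c ⊂ suppSet β},
        ENNReal.ofReal (Real.exp (lam * (l1 β - l1 c) - lam / 2 * l1 (β - c)))
        ∂(priorMeasure dn lam a C) ≤
      ENNReal.ofReal (C * Real.exp (-(lam * l1 c)) * (2 * (dn : ℝ) ^ (-a)) ^ (suppSet c).card *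
        (Real.exp (dn * (2 * (dn : ℝ) ^ (-a))) - 1)) := by
  set B := {β : Fin dn → ℝ | suppSet c ⊂ suppSet β} with hB
  set p : ℝ := (dn : ℝ) ^ (-a) with hp
  have hp0 : 0 ≤ p := by positivity
  have hmodel : ∀ S, suppSet c ⊂ S →
      ∫⁻ β in B, ENNReal.ofReal (Real.exp (lam * (l1 β - l1 c) - lam / 2 * l1 (β - c)))
        ∂(modelMeasure dn lam S) ≤ ENNReal.ofReal (Real.exp (-(lam * l1 c)) * 2 ^ S.card) := by
    intro S _
    calc _ ≤ ∫⁻ β, ENNReal.ofReal (Real.exp (lam * (l1 β - l1 c) - lam / 2 * l1 (β - c)))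
          ∂(modelMeasure dn lam S) := setLIntegral_le_lintegral _ _
      _ = ∫⁻ β, ENNReal.ofReal (Real.exp (-(lam * l1 c))) *
          ENNReal.ofReal (Real.exp (lam * l1 β - lam / 2 * l1 (β - c)))
          ∂(modelMeasure dn lam S) := by
          refine lintegral_congr fun β => ?_
          rw [← ENNReal.ofReal_mul (Real.exp_pos _).le, ← Real.exp_add]
          ring_nf
      _ ≤ ENNReal.ofReal (Real.exp (-(lam * l1 c))) * 2 ^ S.card := by
          rw [lintegral_const_mul' _ _ ENNReal.ofReal_ne_top]
          exact mul_le_mul' le_rfl (lintegral_modelMeasure_le hlam S c)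
      _ = _ := by
          rw [ENNReal.ofReal_mul (Real.exp_pos _).le, ENNReal.ofReal_pow (by norm_num)]
          simp
  have hweight : ∀ S : Finset (Fin dn), suppSet c ⊂ S →
      C * ((dn.choose S.card : ℝ))⁻¹ * p ^ S.card * (Real.exp (-(lam * l1 c)) * 2 ^ S.card) ≤
        C * Real.exp (-(lam * l1 c)) * (2 * p) ^ (suppSet c).card *
          (2 * p) ^ (S.card - (suppSet c).card) := by
    intro S hS
    have h1 : ((dn.choose S.card : ℝ))⁻¹ ≤ 1 := by
      refine inv_le_one_of_one_le₀ ?_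
      exact_mod_cast Nat.choose_pos (by simpa using S.card_le_univ)
    rw [mul_assoc _ ((2 * p) ^ _) _, ← pow_add, Nat.add_sub_cancel' (Finset.card_le_card hS.1),
      mul_pow]
    have h2 : 0 ≤ C * Real.exp (-(lam * l1 c)) * (2 ^ S.card * p ^ S.card) := by positivity
    calc _ = ((dn.choose S.card : ℝ))⁻¹ *
          (C * Real.exp (-(lam * l1 c)) * (2 ^ S.card * p ^ S.card)) := by ring
      _ ≤ _ := mul_le_of_le_one_left h2 h1
  rw [priorMeasure, ← Measure.sum_fintype, Measure.restrict_sum_of_countable,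
    lintegral_sum_measure, tsum_fintype]
  calc _ = ∑ S : Finset (Fin dn), ENNReal.ofReal (C * ((dn.choose S.card : ℝ))⁻¹ * p ^ S.card) *
        ∫⁻ β in B, ENNReal.ofReal (Real.exp (lam * (l1 β - l1 c) - lam / 2 * l1 (β - c)))
          ∂(modelMeasure dn lam S) := Finset.sum_congr rfl fun S _ => by
        rw [Measure.restrict_smul, lintegral_smul_measure, smul_eq_mul]
    _ = ∑ S with suppSet c ⊂ S, ENNReal.ofReal (C * ((dn.choose S.card : ℝ))⁻¹ * p ^ S.card) *
        ∫⁻ β in B, ENNReal.ofReal (Real.exp (lam * (l1 β - l1 c) - lam / 2 * l1 (β - c)))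
          ∂(modelMeasure dn lam S) := by
        refine (Finset.sum_filter_of_ne fun S _ hne => ?_).symm
        by_contra hS
        exact hne (by rw [setLIntegral_measure_zero _ _ (modelMeasure_superset_eq_zero lam hS),
          mul_zero])
    _ ≤ ∑ S with suppSet c ⊂ S, ENNReal.ofReal (C * Real.exp (-(lam * l1 c)) *
          (2 * p) ^ (suppSet c).card * (2 * p) ^ (S.card - (suppSet c).card)) := by
        refine Finset.sum_le_sum fun S hS => ?_
        have hS' := (Finset.mem_filter.1 hS).2
        refine (mul_le_mul' le_rfl (hmodel S hS')).trans ?_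
        rw [← ENNReal.ofReal_mul (by positivity)]
        exact ENNReal.ofReal_le_ofReal (hweight S hS')
    _ ≤ _ := by
        rw [← ENNReal.ofReal_sum_of_nonneg fun S _ => by positivity, ← Finset.mul_sum]
        refine ENNReal.ofReal_le_ofReal (mul_le_mul_of_nonneg_left ?_ (by positivity))
        exact sum_ssuperset_pow_le _ (by positivity)

lemma le_lintegral_priorMeasure {dn : ℕ} {lam a C : ℝ} (hlam : 0 < lam) (hC : 0 ≤ C)
    (c : Fin dn → ℝ) {ρ κ : ℝ} (hρ : 0 < ρ) {F : (Fin dn → ℝ) → ENNReal}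
    (hF : ∀ β ∈ Set.univ.pi fun j => Set.Icc (c j - ρ) (c j + ρ), ENNReal.ofReal κ ≤ F β) :
    ENNReal.ofReal (C * ((dn.choose (suppSet c).card : ℝ))⁻¹ *
        ((dn : ℝ) ^ (-a)) ^ (suppSet c).card *
        ((lam * ρ * Real.exp (-(lam * ρ))) ^ (suppSet c).card * Real.exp (-(lam * l1 c))) * κ) ≤
      ∫⁻ β, F β ∂(priorMeasure dn lam a C) := by
  set Q := Set.univ.pi fun j => Set.Icc (c j - ρ) (c j + ρ) with hQ
  have hQm : MeasurableSet Q := MeasurableSet.univ_pi fun j => measurableSet_Icc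
  rw [priorMeasure, lintegral_finsetSum_measure]
  refine le_trans ?_ (Finset.single_le_sum (fun _ _ => zero_le) (Finset.mem_univ (suppSet c)))
  rw [lintegral_smul_measure, smul_eq_mul, ENNReal.ofReal_mul (by positivity),
    ENNReal.ofReal_mul (by positivity), mul_assoc]
  refine mul_le_mul' le_rfl ?_
  calc _ ≤ modelMeasure dn lam (suppSet c) Q * ENNReal.ofReal κ :=
        mul_le_mul' (le_modelMeasure_box hlam c hρ) le_rfl
    _ = ∫⁻ _ in Q, ENNReal.ofReal κ ∂(modelMeasure dn lam (suppSet c)) := by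
        rw [setLIntegral_const, mul_comm]
    _ ≤ ∫⁻ β in Q, F β ∂(modelMeasure dn lam (suppSet c)) := setLIntegral_mono' hQm hF
    _ ≤ _ := setLIntegral_le_lintegral _ _

end Prior

section Numerics

/-- The complexity penalty `d^{-a}` on the extra coordinates beats the inverse of the prior mass
near the truth. -/
lemma complexity_bound {d s : ℕ} (hd : 3 ≤ d) (hs : 0 < s) {a b R t : ℝ} (hsb : (s : ℝ) ≤ b)
    (hR : 0 ≤ R) (ha : 1 + 16 * b + 98 * b * R ≤ a) (ht : Real.exp (-(4 * Real.log d)) ≤ t) :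
    (Real.exp (d * (2 * (d : ℝ) ^ (-a))) - 1) * 2 ^ s *
        (Real.exp (15 * b * R * Real.log d) + 1) * (d.choose s : ℝ) ≤
      8 * Real.exp 1 / d * (t ^ s * Real.exp (-√(Real.log d) - 1)) := by
  have hd3 : (3 : ℝ) ≤ d := by exact_mod_cast hd
  have hd0 : (0 : ℝ) < d := by linarith
  set l := Real.log d with hl
  have hl1 : 1 ≤ l := by
    rw [hl, Real.le_log_iff_exp_le hd0]
    linarith [Real.exp_one_lt_d9]
  have hexpl : Real.exp l = d := Real.exp_log hd0
  have hs1 : (1 : ℝ) ≤ s := by exact_mod_cast hs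
  have hb1 : 1 ≤ b := hs1.trans hsb
  have hbR : 0 ≤ b * R := by positivity
  have hsl : s * l ≤ b * l := by gcongr
  have hbRl : 0 ≤ b * R * l := by positivity
  have hpow : ∀ k : ℕ, (d : ℝ) ^ k = Real.exp (k * l) := fun k => by
    rw [Real.exp_nat_mul, hexpl]
  have hdp : d * (2 * (d : ℝ) ^ (-a)) = 2 * Real.exp ((1 - a) * l) := by
    rw [Real.rpow_def_of_pos hd0, ← hl, sub_mul, one_mul, sub_eq_add_neg, Real.exp_add, hexpl]
    ring_nf
  have hsmall : 2 * Real.exp ((1 - a) * l) ≤ 1 := by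
    have h1 : (1 - a) * l ≤ -1 := by nlinarith
    have h2 : Real.exp (-1) ≤ 1 / 2 := by
      rw [Real.exp_neg, inv_eq_one_div]
      exact one_div_le_one_div_of_le two_pos (by linarith [Real.exp_one_gt_d9])
    linarith [Real.exp_le_exp.2 h1]
  have e1 : Real.exp (d * (2 * (d : ℝ) ^ (-a))) - 1 ≤ 4 * Real.exp ((1 - a) * l) := by
    rw [hdp]
    have h0 : 0 ≤ 2 * Real.exp ((1 - a) * l) := by positivity
    have := Real.abs_exp_sub_one_le (x := 2 * Real.exp ((1 - a) * l)) (by rwa [abs_of_nonneg h0])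
    rw [abs_of_nonneg h0] at this
    linarith [le_abs_self (Real.exp (2 * Real.exp ((1 - a) * l)) - 1)]
  have e2 : (2 : ℝ) ^ s ≤ Real.exp (b * l) := by
    calc (2 : ℝ) ^ s ≤ (d : ℝ) ^ s := by
          gcongr
          linarith
      _ ≤ _ := by
          rw [hpow]
          exact Real.exp_le_exp.2 hsl
  have e3 : Real.exp (15 * b * R * l) + 1 ≤ 2 * Real.exp (15 * b * R * l) := by
    have : 1 ≤ Real.exp (15 * b * R * l) := Real.one_le_exp (by linarith)
    linarith
  have e4 : (d.choose s : ℝ) ≤ Real.exp (b * l) := by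
    calc (d.choose s : ℝ) ≤ (d : ℝ) ^ s := by exact_mod_cast Nat.choose_le_pow d s
      _ ≤ _ := by
          rw [hpow]
          exact Real.exp_le_exp.2 hsl
  have e5 : Real.exp (-(4 * (b * l))) ≤ t ^ s := by
    calc _ ≤ Real.exp (s * -(4 * l)) := Real.exp_le_exp.2 (by linarith)
      _ = Real.exp (-(4 * l)) ^ s := Real.exp_nat_mul _ _
      _ ≤ _ := by gcongr
  have e6 : Real.exp (-l - 1) ≤ Real.exp (-√l - 1) := by
    refine Real.exp_le_exp.2 ?_
    have : √l ≤ l := Real.sqrt_le_iff.2 ⟨by linarith, by nlinarith⟩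
    linarith
  have ht0 : 0 < t := (Real.exp_pos _).trans_le ht
  calc _ ≤ 4 * Real.exp ((1 - a) * l) * Real.exp (b * l) *
        (2 * Real.exp (15 * b * R * l)) * Real.exp (b * l) := by gcongr
    _ = 8 * Real.exp ((1 - a) * l + b * l + 15 * b * R * l + b * l) := by
        simp only [Real.exp_add]
        ring
    _ ≤ 8 * Real.exp (1 - l - 4 * (b * l) + (-l - 1)) := by
        refine mul_le_mul_of_nonneg_left (Real.exp_le_exp.2 ?_) (by norm_num)
        have h1 := mul_le_mul_of_nonneg_right ha (zero_le_one.trans hl1)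
        have h2 := mul_le_mul_of_nonneg_right hb1 (zero_le_one.trans hl1)
        linarith
    _ = 8 * Real.exp 1 / d * (Real.exp (-(4 * (b * l))) * Real.exp (-l - 1)) := by
        rw [Real.exp_add, sub_eq_add_neg _ (4 * (b * l)), Real.exp_add, Real.exp_sub, hexpl]
        ring
    _ ≤ _ := by gcongr

lemma exp_neg_four_log_le {d n : ℕ} (hd : 3 ≤ d) (hn : 0 < n) (hnd : n < d) {x : ℝ}
    (hx : 1 / (n * d ^ 2 : ℝ) ≤ x) (hx1 : x ≤ 1) :
    Real.exp (-(4 * Real.log d)) ≤ x * Real.exp (-x) := by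
  have hd3 : (3 : ℝ) ≤ d := by exact_mod_cast hd
  have hd0 : (0 : ℝ) < d := by linarith
  have hn0 : (0 : ℝ) < n := by exact_mod_cast hn
  have h1 : Real.exp (-(4 * Real.log d)) = 1 / (d : ℝ) ^ 3 * (1 / d) := by
    rw [Real.exp_neg, mul_comm, Real.exp_mul, Real.exp_log hd0,
      show (4 : ℝ) = ((4 : ℕ) : ℝ) by norm_num, Real.rpow_natCast]
    field_simp
  have h2 : 1 / (d : ℝ) ^ 3 ≤ x := by
    refine le_trans (one_div_le_one_div_of_le (by positivity) ?_) hx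
    have : (n : ℝ) ≤ d := by exact_mod_cast hnd.le
    calc _ ≤ (d : ℝ) * d ^ 2 := by gcongr
      _ = _ := by ring
  have h3 : 1 / (d : ℝ) ≤ Real.exp (-x) := by
    calc 1 / (d : ℝ) ≤ 1 / Real.exp 1 :=
          one_div_le_one_div_of_le (Real.exp_pos _) (by linarith [Real.exp_one_lt_d9])
      _ = Real.exp (-1) := by rw [Real.exp_neg, one_div]
      _ ≤ _ := Real.exp_le_exp.2 (by linarith)
  rw [h1]
  exact mul_le_mul h2 h3 (by positivity) (le_trans (by positivity) h2)

end Numerics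

section PosteriorBound

variable {μ : Measure ℝ} {h T A ηf : ℝ → ℝ} {M0 : ℝ} {domA : Set ℝ}

lemma bregman_comp_le (hη : ∀ t, ηf t ∈ interior domA) (hsmooth : ContDiffOn ℝ 2 A domA)
    (hclip : ∀ t, 0 ≤ deriv (deriv A) (ηf t) ∧ deriv (deriv A) (ηf t) ≤ M0 ^ 2 / 2)
    (hcont : Continuous ηf) (s t : ℝ) :
    A (ηf t) - A (ηf s) - (ηf t - ηf s) * deriv A (ηf s) ≤ M0 ^ 2 / 2 * (ηf t - ηf s) ^ 2 := by
  have hA : ContDiffOn ℝ 2 A (interior domA) := hsmooth.mono interior_subset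
  have hA' : ContDiffOn ℝ 1 (deriv A) (interior domA) :=
    hA.deriv_of_isOpen isOpen_interior (by norm_num [one_add_one_eq_two])
  refine bregman_le (J := Set.range ηf) ?_ ?_ ?_ ?_ (Set.mem_range_self s) (Set.mem_range_self t)
  · exact (isPreconnected_range hcont).ordConnected.convex
  · rintro _ ⟨t, rfl⟩
    exact (hA.differentiableOn two_ne_zero).differentiableAt (isOpen_interior.mem_nhds (hη t))
  · rintro _ ⟨t, rfl⟩
    exact (hA'.differentiableOn one_ne_zero).differentiableAt (isOpen_interior.mem_nhds (hη t))
  · rintro _ ⟨t, rfl⟩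
    rw [abs_of_nonneg (hclip t).1]
    exact (hclip t).2

lemma klDiv_le (hη : ∀ t, ηf t ∈ interior domA) (hsmooth : ContDiffOn ℝ 2 A domA)
    (hclip : ∀ t, 0 ≤ deriv (deriv A) (ηf t) ∧ deriv (deriv A) (ηf t) ≤ M0 ^ 2 / 2)
    (hlip : LipschitzWith 1 ηf) {n dn : ℕ} (X : Matrix (Fin n) (Fin dn) ℝ) (c β : Fin dn → ℝ) :
    klDiv A (etaVec ηf X c) (etaVec ηf X β) ≤
      n * (M0 ^ 2 / 2 * (Xnorm X * l1 (β - c)) ^ 2) := by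
  calc _ ≤ ∑ _i : Fin n, M0 ^ 2 / 2 * (Xnorm X * l1 (β - c)) ^ 2 :=
        Finset.sum_le_sum fun i _ => by
          refine (bregman_comp_le hη hsmooth hclip hlip.continuous _ _).trans ?_
          refine mul_le_mul_of_nonneg_left ?_ (by positivity)
          exact sq_le_sq' (abs_le.1 (abs_etaVec_sub_le hlip X β c i)).1
            (abs_le.1 (abs_etaVec_sub_le hlip X β c i)).2
    _ = _ := by simp

lemma logLR_lower_bound (hM0 : 0 < M0) (hη : ∀ t, ηf t ∈ interior domA)
    (hsmooth : ContDiffOn ℝ 2 A domA)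
    (hclip : ∀ t, 0 ≤ deriv (deriv A) (ηf t) ∧ deriv (deriv A) (ηf t) ≤ M0 ^ 2 / 2)
    (hlip : LipschitzWith 1 ηf) {n dn : ℕ} (hn : 0 < n) {X : Matrix (Fin n) (Fin dn) ℝ}
    (hM : 0 < Mconst M0 X) {c β : Fin dn → ℝ} (hβ : l1 (β - c) ≤ 1 / (Mconst M0 X * n))
    {y : Fin n → ℝ} {r : ℝ} (hr : 0 ≤ r)
    (hy : absNoise μ h T A (etaVec ηf X c) y ≤ n * M0 * r) :
    -r - 1 ≤ logLR μ h T A ηf X c β y := by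
  have hn1 : (1 : ℝ) ≤ n := by exact_mod_cast hn
  have hn0 : (0 : ℝ) < n := by linarith
  have hZ := abs_centeredZ_le μ h T A (abs_etaVec_sub_le hlip X β c) y
  have hXM := Xnorm_mul_le_Mconst hM0 X
  have hK : 0 ≤ Xnorm X * l1 (β - c) := mul_nonneg (Xnorm_nonneg X) (l1_nonneg _)
  have hKM : Xnorm X * l1 (β - c) * M0 ≤ 1 / n := by
    calc _ = Xnorm X * M0 * l1 (β - c) := by ring
      _ ≤ Mconst M0 X * (1 / (Mconst M0 X * n)) :=
          mul_le_mul hXM hβ (l1_nonneg _) hM.le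
      _ = 1 / n := by field_simp
  have hZ2 : Xnorm X * l1 (β - c) * absNoise μ h T A (etaVec ηf X c) y ≤ r := by
    calc _ ≤ Xnorm X * l1 (β - c) * (n * M0 * r) := mul_le_mul_of_nonneg_left hy hK
      _ = Xnorm X * l1 (β - c) * M0 * (n * r) := by ring
      _ ≤ 1 / n * (n * r) := mul_le_mul_of_nonneg_right hKM (by positivity)
      _ = r := by field_simp
  have hD : klDiv A (etaVec ηf X c) (etaVec ηf X β) ≤ 1 := by
    calc _ ≤ n * (M0 ^ 2 / 2 * (Xnorm X * l1 (β - c)) ^ 2) :=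
          klDiv_le hη hsmooth hclip hlip X c β
      _ = n * ((Xnorm X * l1 (β - c) * M0) ^ 2 / 2) := by ring
      _ ≤ n * ((1 / n) ^ 2 / 2) := by gcongr
      _ = 1 / n / 2 := by field_simp
      _ ≤ 1 := by
          have : 1 / (n : ℝ) ≤ 1 := (div_le_one hn0).2 hn1
          linarith
  rw [logLR]
  linarith [(abs_le.1 hZ).1]

lemma Mconst_pos_of_klDiv_lower_bound (hM0 : 0 < M0) (hlip : LipschitzWith 1 ηf) {n dn : ℕ}
    (hn : 0 < n) {X : Matrix (Fin n) (Fin dn) ℝ} {c : Fin dn → ℝ} (hc : 0 < (suppSet c).card)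
    {φ : ℝ} (hφ : 0 < φ)
    (hIC : ∀ β, 0 < l1 (restr (suppSet c) (β - c)) →
      l1 (restr (suppSet c)ᶜ (β - c)) < 7 * l1 (restr (suppSet c) (β - c)) →
      n * φ ^ 2 / (suppSet c).card * l1 (restr (suppSet c) (β - c)) ^ 2 ≤
        klDiv A (etaVec ηf X c) (etaVec ηf X β)) :
    0 < Mconst M0 X := by
  refine lt_of_lt_of_le (lt_of_le_of_ne (Xnorm_nonneg X) fun h0 => ?_) (Xnorm_le_Mconst hM0 X)
  have heta : etaVec ηf X 0 = etaVec ηf X c := funext fun i => by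
    have := abs_etaVec_sub_le hlip X 0 c i
    rw [← h0, zero_mul] at this
    exact sub_eq_zero.1 (abs_nonpos_iff.1 this)
  have hu : 0 < l1 (restr (suppSet c) (0 - c)) := by
    rw [l1_restr]
    refine Finset.sum_pos (fun j hj => ?_) (Finset.card_pos.1 hc)
    simpa [suppSet] using hj
  have hv : l1 (restr (suppSet c)ᶜ (0 - c)) = 0 := by
    rw [l1_restr]
    refine Finset.sum_eq_zero fun j hj => ?_
    simpa [suppSet] using hj
  have h1 := hIC 0 hu (by rw [hv]; linarith)
  have h2 : klDiv A (etaVec ηf X c) (etaVec ηf X 0) = 0 := by simp [heta, klDiv]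
  rw [h2] at h1
  have hn0 : (0 : ℝ) < n := by exact_mod_cast hn
  have hc0 : (0 : ℝ) < (suppSet c).card := by exact_mod_cast hc
  exact absurd h1 (not_le.2 (by positivity))

lemma exp_logLR_upper_bound (hM0 : 0 < M0) (hlip : LipschitzWith 1 ηf) {n dn : ℕ} (hn : 0 < n)
    {X : Matrix (Fin n) (Fin dn) ℝ} {c : Fin dn → ℝ} (hc : 0 < (suppSet c).card) {b : ℝ}
    (hcb : ((suppSet c).card : ℝ) ≤ b) {φ : ℝ} (hφ : 0 < φ)
    (hIC : ∀ β, 0 < l1 (restr (suppSet c) (β - c)) →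
      l1 (restr (suppSet c)ᶜ (β - c)) < 7 * l1 (restr (suppSet c) (β - c)) →
      n * φ ^ 2 / (suppSet c).card * l1 (restr (suppSet c) (β - c)) ^ 2 ≤
        klDiv A (etaVec ηf X c) (etaVec ηf X β))
    {lam r : ℝ} (hlam : 0 ≤ lam) (hr : 0 ≤ r) (hlamM : lam ≤ Mconst M0 X * r)
    {y : Fin n → ℝ} (hy : absNoise μ h T A (etaVec ηf X c) y ≤ n * M0 * r) (β : Fin dn → ℝ) :
    Real.exp (logLR μ h T A ηf X c β y) ≤
      Real.exp (lam * (l1 β - l1 c) - lam / 2 * l1 (β - c)) *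
        (Real.exp (15 * b * (Mconst M0 X ^ 2 / φ ^ 2) * r ^ 2) *
          Real.exp (logLR μ h T A ηf X c β y) + 1) := by
  have hn1 : (1 : ℝ) ≤ n := by exact_mod_cast hn
  have hc0 : (0 : ℝ) < (suppSet c).card := by exact_mod_cast hc
  have hb0 : 0 < b := hc0.trans_le hcb
  have hM : 0 ≤ Mconst M0 X := (Xnorm_nonneg X).trans (Xnorm_le_Mconst hM0 X)
  have hsplit := l1_restr_add_compl (suppSet c) (β - c)
  refine exp_le_exp_mul_of_divergence (l1_nonneg (restr (suppSet c) (β - c)))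
    (l1_nonneg (restr (suppSet c)ᶜ (β - c))) hlam hlamM hn1 ?_ ?_ (hIC β) (by positivity)
    (τ := 10 * b * (Mconst M0 X / φ ^ 2) * r) (by positivity) ?_ (le_of_eq (by ring))
  · have hZ := le_of_abs_le (abs_centeredZ_le μ h T A (abs_etaVec_sub_le hlip X β c) y)
    refine sub_le_sub_right (hZ.trans ?_) _
    rw [hsplit]
    calc _ ≤ Xnorm X * l1 (β - c) * (n * M0 * r) :=
          mul_le_mul_of_nonneg_left hy (mul_nonneg (Xnorm_nonneg X) (l1_nonneg _))
      _ = Xnorm X * M0 * (n * r * l1 (β - c)) := by ring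
      _ ≤ Mconst M0 X * (n * r * l1 (β - c)) :=
          mul_le_mul_of_nonneg_right (Xnorm_mul_le_Mconst hM0 X)
            (mul_nonneg (by positivity) (l1_nonneg _))
      _ = _ := by ring
  · have h1 := mul_le_mul_of_nonneg_left (l1_restr_suppSet_sub_le β c) hlam
    rw [← hsplit]
    linarith
  · calc 10 * (n * (Mconst M0 X * r)) = n * φ ^ 2 / b * (10 * b * (Mconst M0 X / φ ^ 2) * r) := by
          field_simp
      _ ≤ _ := by gcongr

/-- Nonasymptotic bound for the expected posterior mass of strict supermodels. -/
lemma integral_posterior_superset_le [SigmaFinite μ] (hM0 : 0 < M0)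
    (hη : ∀ t, ηf t ∈ interior domA) (hsmooth : ContDiffOn ℝ 2 A domA)
    (hhpos : ∀ y, 0 ≤ h y) (hmh : Measurable h) (hmT : Measurable T)
    (hprob : ∀ θ ∈ domA, IsProbabilityMeasure (expFamMeasure μ h T A θ))
    (hclip : ∀ t, 0 ≤ deriv (deriv A) (ηf t) ∧ deriv (deriv A) (ηf t) ≤ M0 ^ 2 / 2)
    (hlip : LipschitzWith 1 ηf) {n dn : ℕ} (hn : 0 < n) (hnd : n < dn) (hd : 3 ≤ dn)
    {X : Matrix (Fin n) (Fin dn) ℝ} {lam a C b φ : ℝ} (hC : 0 < C)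
    (hlam : Mconst M0 X / dn ≤ lam) (hlamM : lam ≤ Mconst M0 X * √(Real.log dn))
    [IsProbabilityMeasure (priorMeasure dn lam a C)] {c : Fin dn → ℝ}
    (hc : 0 < (suppSet c).card) (hcb : ((suppSet c).card : ℝ) ≤ b) (hφ : 0 < φ)
    (hIC : ∀ β, 0 < l1 (restr (suppSet c) (β - c)) →
      l1 (restr (suppSet c)ᶜ (β - c)) < 7 * l1 (restr (suppSet c) (β - c)) →
      n * φ ^ 2 / (suppSet c).card * l1 (restr (suppSet c) (β - c)) ^ 2 ≤
        klDiv A (etaVec ηf X c) (etaVec ηf X β))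
    (ha : 1 + 16 * b + 98 * b * (Mconst M0 X ^ 2 / φ ^ 2) ≤ a) :
    ∫ y, posterior μ h T A ηf dn X c lam a C {β | suppSet c ⊂ suppSet β} y
        ∂(dataMeasure μ h T A n (etaVec ηf X c)) ≤
      1 / √(Real.log dn) + 8 * Real.exp 1 / dn := by
  have hM : 0 < Mconst M0 X := Mconst_pos_of_klDiv_lower_bound hM0 hlip hn hc hφ hIC
  have hn1 : (1 : ℝ) ≤ n := by exact_mod_cast hn
  have hn0 : (0 : ℝ) < n := by linarith
  have hd3 : (3 : ℝ) ≤ dn := by exact_mod_cast hd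
  have hd0 : (0 : ℝ) < dn := by linarith
  have hlog : 1 ≤ Real.log dn := by
    rw [Real.le_log_iff_exp_le hd0]
    linarith [Real.exp_one_lt_d9]
  have hr : 0 < √(Real.log dn) := Real.sqrt_pos.2 (by linarith)
  have hlam0 : 0 < lam := (by positivity : 0 < Mconst M0 X / dn).trans_le hlam
  have hint : ∀ θ, etaVec ηf X c θ ∈ interior domA := fun i => hη _
  have : ∀ i, IsProbabilityMeasure (expFamMeasure μ h T A (etaVec ηf X c i)) :=
    fun i => hprob _ (interior_subset (hint i))
  have : IsProbabilityMeasure (dataMeasure μ h T A n (etaVec ηf X c)) := by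
    rw [dataMeasure]
    infer_instance
  have hAη : Measurable fun t => A (ηf t) :=
    (hsmooth.continuousOn.comp_continuous hlip.continuous
      fun t => interior_subset (hη t)).measurable
  set W := {y | absNoise μ h T A (etaVec ηf X c) y ≤ n * M0 * √(Real.log dn)} with hW
  have hWm : MeasurableSet W := measurableSet_le (measurable_absNoise hmT _) measurable_const
  have hPW : dataMeasure μ h T A n (etaVec ηf X c) Wᶜ ≤ ENNReal.ofReal (1 / √(Real.log dn)) := by
    have h1 := measure_absNoise_gt_le hhpos hmh hmT hprob hM0 hint (fun i => (hclip _).2)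
      (t := n * M0 * √(Real.log dn)) (by positivity)
    have h2 : Wᶜ = {y | n * M0 * √(Real.log dn) < absNoise μ h T A (etaVec ηf X c) y} := by
      ext y
      simp [hW]
    rw [h2]
    refine h1.trans_eq (congrArg _ ?_)
    field_simp
  refine integral_le_of_lintegral_ofReal_le
    (fun y => div_nonneg (integral_nonneg fun β => (Real.exp_pos _).le)
      (integral_nonneg fun β => (Real.exp_pos _).le)) (by positivity) ?_
  rw [ENNReal.ofReal_add (by positivity) (by positivity)]
  set ρ : ℝ := 1 / (Mconst M0 X * n * dn) with hρ
  have hρ0 : 0 < ρ := by positivity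
  set t := lam * ρ * Real.exp (-(lam * ρ)) with ht
  set κ := Real.exp (-√(Real.log dn) - 1) with hκ
  have hsd : (suppSet c).card ≤ dn := by simpa using (suppSet c).card_le_univ
  have hchoose : (0 : ℝ) < dn.choose (suppSet c).card := by exact_mod_cast Nat.choose_pos hsd
  refine lintegral_ratio_le (f := fun β y => Real.exp (logLR μ h T A ηf X c β y))
    (G := ENNReal.ofReal
      (Real.exp (15 * b * (Mconst M0 X ^ 2 / φ ^ 2) * Real.log dn)))
    (g := fun β => ENNReal.ofReal (Real.exp (lam * (l1 β - l1 c) - lam / 2 * l1 (β - c))))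
    (c := ENNReal.ofReal (C * ((dn.choose (suppSet c).card : ℝ))⁻¹ *
        ((dn : ℝ) ^ (-a)) ^ (suppSet c).card *
        (t ^ (suppSet c).card * Real.exp (-(lam * l1 c))) * κ)) (W := W) _ _
    (fun _ _ => (Real.exp_pos _).le)
    (measurable_logLR hmT hlip.continuous.measurable hAη X c).exp
    (fun β => (lintegral_exp_logLR hhpos hmh hmT hprob hη X c β).le) _ ?_ hWm hPW ?_
    ENNReal.ofReal_ne_top (fun y hy => ?_) (fun y hy β => ?_) ?_
  · unfold l1
    fun_prop
  · exact (ENNReal.ofReal_pos.2 (by positivity)).ne'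
  · refine le_lintegral_priorMeasure hlam0 hC.le c hρ0 fun β hβ =>
      ENNReal.ofReal_le_ofReal (Real.exp_le_exp.2 ?_)
    refine logLR_lower_bound hM0 hη hsmooth hclip hlip hn hM ?_ hr.le hy
    calc l1 (β - c) ≤ ∑ _j : Fin dn, ρ := Finset.sum_le_sum fun j _ => by
          have := hβ j trivial
          exact abs_le.2 ⟨by simpa using this.1, by simpa [add_comm] using this.2⟩
      _ = 1 / (Mconst M0 X * n) := by
          simp only [Finset.sum_const, Finset.card_univ, Fintype.card_fin, nsmul_eq_mul, hρ]
          field_simp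
  · have h1 := exp_logLR_upper_bound hM0 hlip hn hc hcb hφ hIC hlam0.le hr.le hlamM hy β
    rw [Real.sq_sqrt (by linarith)] at h1
    rw [← ENNReal.ofReal_one, ← ENNReal.ofReal_mul (Real.exp_pos _).le,
      ← ENNReal.ofReal_add (by positivity) zero_le_one, ← ENNReal.ofReal_mul (Real.exp_pos _).le]
    exact ENNReal.ofReal_le_ofReal h1
  · refine (mul_le_mul' (lintegral_superset_priorMeasure_le hlam0 hC.le c) le_rfl).trans ?_
    rw [← ENNReal.ofReal_one, ← ENNReal.ofReal_add (Real.exp_pos _).le zero_le_one,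
      ← ENNReal.ofReal_mul' (by positivity), ← ENNReal.ofReal_mul (by positivity)]
    refine ENNReal.ofReal_le_ofReal ?_
    have hx : 1 / (n * dn ^ 2 : ℝ) ≤ lam * ρ := by
      calc 1 / (n * dn ^ 2 : ℝ) = Mconst M0 X / dn * ρ := by
            rw [hρ]
            field_simp
        _ ≤ _ := by gcongr
    have hx1 : lam * ρ ≤ 1 := by
      have hsq : √(Real.log dn) ≤ n * dn := by
        refine Real.sqrt_le_iff.2 ⟨by positivity, ?_⟩
        have h1 : Real.log dn ≤ dn := (Real.log_le_sub_one_of_pos hd0).trans (by linarith)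
        have h2 : (dn : ℝ) ≤ n * dn := le_mul_of_one_le_left hd0.le hn1
        nlinarith
      calc lam * ρ ≤ Mconst M0 X * √(Real.log dn) * ρ := by gcongr
        _ ≤ Mconst M0 X * (n * dn) * ρ := by gcongr
        _ = 1 := by
            rw [hρ]
            field_simp
    have hmain := complexity_bound hd hc hcb (by positivity) ha
      (exp_neg_four_log_le hd hn hnd hx hx1)
    rw [mul_pow]
    set p := ((dn : ℝ) ^ (-a)) ^ (suppSet c).card with hp
    have hp0 : 0 < p := by positivity
    rw [← le_div_iff₀ hchoose] at hmain
    have hmain2 := mul_le_mul_of_nonneg_left hmain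
      (by positivity : 0 ≤ C * Real.exp (-(lam * l1 c)) * p)
    refine le_trans (le_of_eq ?_) (hmain2.trans_eq ?_)
    · ring
    · rw [← ht, ← hκ]
      ring

end PosteriorBound

/-- **Corollary 1** (weak model selection consistency). -/
theorem corollary1_weak_model_selection
    (μ : Measure ℝ) [SigmaFinite μ]
    (h T A ηf : ℝ → ℝ) (M0 : ℝ) (hM0 : 0 < M0)
    (domA : Set ℝ) (hdomA : Convex ℝ domA) (hrange : ∀ t : ℝ, ηf t ∈ domA)
    (hconv : ConvexOn ℝ domA A) (hsmooth : ContDiffOn ℝ 2 A domA)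
    (hhpos : ∀ y, 0 ≤ h y) (hmh : Measurable h) (hmT : Measurable T)
    (hlogpart : ∀ θ ∈ domA, Real.exp (A θ) = ∫ y, h y * Real.exp (θ * T y) ∂μ)
    (hprob : ∀ θ ∈ domA, IsProbabilityMeasure (expFamMeasure μ h T A θ))
    (hIA : ∀ c : ℝ, 0 < c →
      ({t : ℝ | 0 ≤ deriv (deriv A) t ∧ deriv (deriv A) t ≤ c} : Set ℝ).OrdConnected)
    (hIAtop : ({t : ℝ | 0 ≤ deriv (deriv A) t} : Set ℝ).OrdConnected)
    (hclip : ∀ t : ℝ, 0 ≤ deriv (deriv A) (ηf t) ∧ deriv (deriv A) (ηf t) ≤ M0 ^ 2 / 2)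
    (hlip : LipschitzWith 1 ηf) (hinj : Function.Injective ηf)
    (d : ℕ → ℕ) (hdgt : ∀ n, n < d n)
    (hdinf : Tendsto (fun n => (d n : ℝ)) atTop atTop)
    (b : ℕ → ℝ) (hbpos : ∀ n, 0 < b n)
    (hbo : Tendsto (fun n => b n * Real.log (d n) / n) atTop (nhds 0))
    (X : ∀ n : ℕ, Matrix (Fin n) (Fin (d n)) ℝ)
    (lam a C : ℕ → ℝ) (hCpos : ∀ n, 0 < C n)
    (hL0 : ∀ n, Mconst M0 (X n) / (d n : ℝ) ≤ lam n ∧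
      lam n ≤ Mconst M0 (X n) * Real.sqrt (Real.log (d n)))
    (hprior : ∀ n, IsProbabilityMeasure (priorMeasure (d n) (lam n) (a n) (C n)))
    (φ1 : ∀ n : ℕ, Finset (Fin (d n)) → ℝ)
    (hICmodel : ∀ n : ℕ, ∀ S : Finset (Fin (d n)), 0 < φ1 n S →
      ∀ β1 β2 : Fin (d n) → ℝ, restr S β1 ≠ restr S β2 →
        l1 (restr Sᶜ β2 - restr Sᶜ β1) < 7 * l1 (restr S β2 - restr S β1) →
        (n : ℝ) * φ1 n S ^ 2 / (S.card : ℝ) * l1 (restr S β2 - restr S β1) ^ 2 ≤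
          klDiv A (etaVec ηf (X n) β1) (etaVec ηf (X n) β2))
    (hICmodelEx : ∀ n : ℕ, ∃ S : Finset (Fin (d n)), S.Nonempty ∧ 0 < φ1 n S)
    (hICjoint : ∀ n : ℕ, (Bset d b φ1 n).Nonempty)
    (ha : ∀ n, 1 < a n)
    (hphiB : ∀ n, 0 < phiBn d b φ1 n)
    (haE1 : ∀ n, 1 + 2 * b n *
      (8 * (1 + 49 * Mconst M0 (X n) ^ 2 / (8 * phiBn d b φ1 n ^ 2))) ≤ a n) :
    Tendsto (fun n : ℕ =>
      ⨆ βs ∈ Bset d b φ1 n,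
        ∫ y, posterior μ h T A ηf (d n) (X n) βs (lam n) (a n) (C n)
            {β | suppSet βs ⊂ suppSet β} y
          ∂(dataMeasure μ h T A n (etaVec ηf (X n) βs)))
      atTop (nhds 0) := by
  have hη : ∀ t, ηf t ∈ interior domA :=
    mem_interior_of_continuous_injective hdomA hlip.continuous hinj hrange
  have hbound0 : ∀ n, 0 ≤ 1 / √(Real.log (d n)) + 8 * Real.exp 1 / d n := fun n => by positivity
  refine tendsto_of_tendsto_of_tendsto_of_le_of_le' tendsto_const_nhds
    (h := fun n => 1 / √(Real.log (d n)) + 8 * Real.exp 1 / d n) ?_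
    (Eventually.of_forall fun n => ?_) ?_
  · have h1 : Tendsto (fun n => √(Real.log (d n))) atTop atTop :=
      Real.tendsto_sqrt_atTop.comp (Real.tendsto_log_atTop.comp hdinf)
    simpa using (h1.const_div_atTop 1).add (hdinf.const_div_atTop (8 * Real.exp 1))
  · exact Real.iSup_nonneg fun βs => Real.iSup_nonneg fun _ => integral_nonneg fun y =>
      div_nonneg (integral_nonneg fun β => (Real.exp_pos _).le)
        (integral_nonneg fun β => (Real.exp_pos _).le)
  · filter_upwards [eventually_ge_atTop 2] with n hn
    refine Real.iSup_le (fun βs => Real.iSup_le (fun hβs => ?_) (hbound0 n)) (hbound0 n)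
    have hφle : phiBn d b φ1 n ≤ φ1 n (suppSet βs) :=
      csInf_le ⟨0, by rintro _ ⟨β, hβ, rfl⟩; exact hβ.1.le⟩ ⟨βs, hβs, rfl⟩
    have := hprior n
    have hnd := hdgt n
    refine integral_posterior_superset_le hM0 hη hsmooth hhpos hmh hmT hprob hclip hlip
      (by omega) hnd (by omega) (hCpos n) (hL0 n).1 (hL0 n).2 hβs.2.1 hβs.2.2 (hphiB n)
      (fun β hu hv => ?_) (le_trans (le_of_eq ?_) (haE1 n))
    · rw [restr_sub] at hu
      rw [restr_sub, restr_sub] at hv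
      rw [restr_sub]
      have hne : restr (suppSet βs) βs ≠ restr (suppSet βs) β := fun he => by
        rw [he, sub_self] at hu
        simp [l1] at hu
      refine le_trans ?_ (hICmodel n (suppSet βs) hβs.1 βs β hne hv)
      have := (hphiB n).le
      gcongr
    · have := (hphiB n).ne'
      field_simp
      ring
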